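/- For every integer g ≥ 2 there exists a finite simple graph on g vertices with exactly 2g − 3 edges such that every nonempty subset E' of its edges satisfies |E'| ≤ 2n' − 3, where n' is the number of vertices incident to some edge of E' (i.e., an isostatic graph with well-distributed bars exists on any g ≥ 2 vertices). -/

import Mathlib

open scoped Classical

noncomputable section

/-- The set of vertices incident to some edge of `E'`. -/
def spannedVerts {V : Type*} [Fintype V] [DecidableEq V] (E' : Finset (Sym2 V)) :
    Finset V :=
  Finset.univ.filter (fun i => ∃ e ∈ E', i ∈ e)

/-- The edge joining `u` and `v`, together with all edges joining `u` or `v` to a vertex of `T`. -/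
def bookEdges {V : Type*} [DecidableEq V] (u v : V) (T : Finset V) : Finset (Sym2 V) :=
  insert s(u, v) (T.image (fun x => s(u, x)) ∪ T.image (fun x => s(v, x)))

theorem card_image_mk_left {V : Type*} [DecidableEq V] (u : V) (T : Finset V) :
    (T.image (fun x => s(u, x))).card = T.card :=
  Finset.card_image_of_injective _ fun _ _ h => Sym2.congr_right.mp h

theorem card_bookEdges {V : Type*} [DecidableEq V] {u v : V} {T : Finset V}
    (huv : u ≠ v) (hu : u ∉ T) (hv : v ∉ T) : (bookEdges u v T).card = 2 * T.card + 1 := by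
  unfold bookEdges
  rw [Finset.card_insert_of_notMem, Finset.card_union_of_disjoint, card_image_mk_left,
    card_image_mk_left, two_mul]
  · rw [Finset.disjoint_left]
    simp only [Finset.mem_image]
    rintro _ ⟨x, hx, rfl⟩ ⟨y, hy, h⟩
    simp only [Sym2.eq_iff] at h
    grind
  · simp only [Finset.mem_union, Finset.mem_image, Sym2.eq_iff]
    grind

theorem card_bookEdges_le {V : Type*} [DecidableEq V] (u v : V) (T : Finset V) :
    (bookEdges u v T).card ≤ 2 * T.card + 1 := by
  unfold bookEdges
  refine (Finset.card_insert_le _ _).trans ?_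
  have := Finset.card_union_le (T.image (fun x => s(u, x))) (T.image (fun x => s(v, x)))
  simp only [card_image_mk_left] at this
  omega

theorem mem_spannedVerts_of_mem {V : Type*} [Fintype V] [DecidableEq V] {E : Finset (Sym2 V)}
    {e : Sym2 V} (he : e ∈ E) {x : V} (hx : x ∈ e) : x ∈ spannedVerts E := by
  simpa [spannedVerts] using ⟨e, he, hx⟩

/-- A set of edges all passing through `u` satisfies Laman's counting condition. -/
theorem card_le_of_star {V : Type*} [Fintype V] [DecidableEq V] {E : Finset (Sym2 V)}
    (hE : E.Nonempty) (u : V) (h : ∀ e ∈ E, ∃ x, x ≠ u ∧ e = s(u, x)) :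
    (E.card : ℤ) ≤ 2 * (spannedVerts E).card - 3 := by
  have hsub : E ⊆ ((spannedVerts E).erase u).image (fun x => s(u, x)) := by
    intro e he
    obtain ⟨x, hx, rfl⟩ := h e he
    exact Finset.mem_image_of_mem _
      (Finset.mem_erase.mpr ⟨hx, mem_spannedVerts_of_mem he (Sym2.mem_mk_right u x)⟩)
  have hcard := Finset.card_le_card hsub
  have hu : u ∈ spannedVerts E := by
    obtain ⟨e, he⟩ := hE
    obtain ⟨x, -, rfl⟩ := h e he
    exact mem_spannedVerts_of_mem he (Sym2.mem_mk_left u x)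
  rw [card_image_mk_left] at hcard
  have := Finset.card_erase_add_one hu
  have := hE.card_pos
  omega

/-- Laman's counting condition holds for subsets of `bookEdges u v T`. -/
theorem card_le_of_subset_bookEdges {V : Type*} [Fintype V] [DecidableEq V] {u v : V}
    {T : Finset V} (huv : u ≠ v) (hu : u ∉ T) (hv : v ∉ T) {E : Finset (Sym2 V)}
    (hE : E.Nonempty) (hsub : E ⊆ bookEdges u v T) :
    (E.card : ℤ) ≤ 2 * (spannedVerts E).card - 3 := by
  have hcases : ∀ e ∈ E, e = s(u, v) ∨ (∃ x ∈ T, s(u, x) = e) ∨ ∃ x ∈ T, s(v, x) = e := by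
    intro e he
    simpa [bookEdges] using hsub he
  by_cases hus : u ∈ spannedVerts E
  · by_cases hvs : v ∈ spannedVerts E
    · have hsub' : E ⊆ bookEdges u v (((spannedVerts E).erase u).erase v) := by
        intro e he
        simp only [bookEdges, Finset.mem_insert, Finset.mem_union, Finset.mem_image,
          Finset.mem_erase]
        rcases hcases e he with h | ⟨x, hx, rfl⟩ | ⟨x, hx, rfl⟩
        · exact Or.inl h
        · exact Or.inr (Or.inl ⟨x, ⟨ne_of_mem_of_not_mem hx hv, ne_of_mem_of_not_mem hx hu,
            mem_spannedVerts_of_mem he (Sym2.mem_mk_right _ _)⟩, rfl⟩)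
        · exact Or.inr (Or.inr ⟨x, ⟨ne_of_mem_of_not_mem hx hv, ne_of_mem_of_not_mem hx hu,
            mem_spannedVerts_of_mem he (Sym2.mem_mk_right _ _)⟩, rfl⟩)
      have hle := (Finset.card_le_card hsub').trans (card_bookEdges_le _ _ _)
      have := Finset.card_erase_add_one hus
      have := Finset.card_erase_add_one (Finset.mem_erase.mpr ⟨huv.symm, hvs⟩)
      omega
    · refine card_le_of_star hE u fun e he => ?_
      rcases hcases e he with rfl | ⟨x, hx, rfl⟩ | ⟨x, hx, rfl⟩
      · exact ⟨v, huv.symm, rfl⟩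
      · exact ⟨x, ne_of_mem_of_not_mem hx hu, rfl⟩
      · exact absurd (mem_spannedVerts_of_mem he (Sym2.mem_mk_left _ _)) hvs
  · refine card_le_of_star hE v fun e he => ?_
    rcases hcases e he with rfl | ⟨x, hx, rfl⟩ | ⟨x, hx, rfl⟩
    · exact ⟨u, huv, Sym2.eq_swap⟩
    · exact absurd (mem_spannedVerts_of_mem he (Sym2.mem_mk_left _ _)) hus
    · exact ⟨x, ne_of_mem_of_not_mem hx hv, rfl⟩

theorem not_isDiag_of_mem_bookEdges {V : Type*} [DecidableEq V] {u v : V} {T : Finset V}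
    (huv : u ≠ v) (hu : u ∉ T) (hv : v ∉ T) {e : Sym2 V} (he : e ∈ bookEdges u v T) :
    ¬ e.IsDiag := by
  simp only [bookEdges, Finset.mem_insert, Finset.mem_union, Finset.mem_image] at he
  rcases he with rfl | ⟨x, hx, rfl⟩ | ⟨x, hx, rfl⟩
  · exact huv
  · exact (ne_of_mem_of_not_mem hx hu).symm
  · exact (ne_of_mem_of_not_mem hx hv).symm

/-- For every `g ≥ 2` there exists an isostatic graph on `g` vertices: a finite
simple graph with exactly `2g − 3` edges such that every nonempty edge subset `E'`
spanning `n'` vertices satisfies Laman's counting condition `|E'| ≤ 2n' − 3`. -/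
theorem exists_isostatic_graph (g : ℕ) (hg : 2 ≤ g) :
    ∃ G : SimpleGraph (Fin g),
      (G.edgeSet.ncard : ℤ) = 2 * g - 3 ∧
      ∀ E' : Finset (Sym2 (Fin g)), E'.Nonempty → ↑E' ⊆ G.edgeSet →
        (E'.card : ℤ) ≤ 2 * (spannedVerts E').card - 3 := by
  let u : Fin g := ⟨0, by omega⟩
  let v : Fin g := ⟨1, by omega⟩
  let T : Finset (Fin g) := (Finset.univ.erase u).erase v
  have huv : u ≠ v := by simp [u, v]
  have hu : u ∉ T := by simp [T]
  have hv : v ∉ T := by simp [T]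
  have hT : T.card + 2 = g := by
    have h₁ := Finset.card_erase_add_one (Finset.mem_univ u)
    have h₂ := Finset.card_erase_add_one (Finset.mem_erase.mpr ⟨huv.symm, Finset.mem_univ v⟩)
    rw [Finset.card_univ, Fintype.card_fin] at h₁
    change T.card + 1 = _ at h₂
    omega
  have hedge : (SimpleGraph.fromEdgeSet (bookEdges u v T : Set (Sym2 (Fin g)))).edgeSet =
      (bookEdges u v T : Set (Sym2 (Fin g))) := by
    rw [SimpleGraph.edgeSet_fromEdgeSet, sdiff_eq_left, Set.disjoint_left]
    exact fun e he => not_isDiag_of_mem_bookEdges huv hu hv he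
  refine ⟨SimpleGraph.fromEdgeSet (bookEdges u v T : Set (Sym2 (Fin g))), ?_, ?_⟩
  · rw [hedge, Set.ncard_coe_finset, card_bookEdges huv hu hv]
    omega
  · intro E' hE' hsub
    rw [hedge, Finset.coe_subset] at hsub
    exact card_le_of_subset_bookEdges huv hu hv hE' hsub

end
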